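/- arXiv:1912.11217 — 4 statements merged into one kernel-verified Lean document; each statement's English description precedes it below -/
import Mathlib

section
/- KKT sign conditions for the dual CIL quadratic program: if alpha* belongs to F and minimizes f over F, then there exists a multiplier b' in R such that for every index i: if (H alpha*)_i + b' - y_i > 0 then alpha*_i = l_i, and if (H alpha*)_i + b' - y_i < 0 then alpha*_i = u_i. -/
open Matrix in
/-- Second-order expansion of a quadratic form with symmetric matrix along a line. -/
theorem quadratic_line_expansion {n : ℕ} {H : Matrix (Fin n) (Fin n) ℝ} (hH : H.IsSymm)
    (y a d : Fin n → ℝ) (t : ℝ) :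
    (1 / 2) * ((a + t • d) ⬝ᵥ H *ᵥ (a + t • d)) - y ⬝ᵥ (a + t • d) =
      (1 / 2) * (a ⬝ᵥ H *ᵥ a) - y ⬝ᵥ a + t * (d ⬝ᵥ (H *ᵥ a - y)) +
        t ^ 2 * ((1 / 2) * (d ⬝ᵥ H *ᵥ d)) := by
  have hsymm : a ⬝ᵥ H *ᵥ d = d ⬝ᵥ H *ᵥ a := by
    rw [dotProduct_mulVec, ← mulVec_transpose, hH.eq, dotProduct_comm]
  simp only [mulVec_add, mulVec_smul, dotProduct_add, add_dotProduct, dotProduct_smul,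
    smul_dotProduct, dotProduct_sub, smul_eq_mul, hsymm, dotProduct_comm y d]
  ring

/-- A real polynomial `t * p + t ^ 2 * q` that is nonnegative for small positive `t` has
nonnegative linear coefficient. -/
theorem nonneg_of_forall_small_quadratic_nonneg {p q δ : ℝ} (hδ : 0 < δ)
    (h : ∀ t, 0 < t → t ≤ δ → 0 ≤ t * p + t ^ 2 * q) : 0 ≤ p := by
  by_contra! hp
  have hq : 0 < |q| + 1 := by positivity
  set t := min δ (-p / (2 * (|q| + 1))) with ht
  have ht0 : 0 < t := lt_min hδ (div_pos (neg_pos.2 hp) (by positivity))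
  have h1 : t * (2 * (|q| + 1)) ≤ -p := (le_div_iff₀ (by positivity)).1 (min_le_right _ _)
  have h2 := h t ht0 (min_le_left _ _)
  have h3 : 0 ≤ p + t * q := by
    refine nonneg_of_mul_nonneg_right (a := t) ?_ ht0
    linarith
  nlinarith [mul_le_mul_of_nonneg_left (le_abs_self q) ht0.le]

/-- Two families of values of a function on a finite type, one below the other, are separated
by a real number. -/
theorem exists_separating_value {ι : Type*} [Finite ι] (g : ι → ℝ) {P Q : ι → Prop}
    (h : ∀ i j, P i → Q j → g i ≤ g j) :
    ∃ c, (∀ i, P i → g i ≤ c) ∧ ∀ j, Q j → c ≤ g j := by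
  by_cases hP : ∃ i, P i
  · obtain ⟨i, hi, hmax⟩ := Set.exists_max_image {i | P i} g (Set.toFinite _) hP
    exact ⟨g i, hmax, fun j hj => h i j hi hj⟩
  · obtain ⟨c, hc⟩ := (Set.finite_range g).bddBelow
    exact ⟨c, fun i hi => (hP ⟨i, hi⟩).elim, fun j _ => hc ⟨j, rfl⟩⟩

open Matrix in
/-- KKT sign conditions for the dual CIL quadratic program. -/
theorem cil_dual_kkt_sign
    (n : ℕ) (H : Matrix (Fin n) (Fin n) ℝ) (hH : H.PosSemidef)
    (y l u : Fin n → ℝ) (hlu : ∀ i, l i ≤ u i)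
    (f : (Fin n → ℝ) → ℝ)
    (hf : ∀ α, f α = (1/2) * ∑ i, ∑ j, α i * H i j * α j - ∑ i, y i * α i)
    (αs : Fin n → ℝ)
    (hfeas : ∑ i, αs i = 0 ∧ ∀ i, l i ≤ αs i ∧ αs i ≤ u i)
    (hmin : ∀ α : Fin n → ℝ,
      (∑ i, α i = 0 ∧ ∀ i, l i ≤ α i ∧ α i ≤ u i) → f αs ≤ f α) :
    ∃ b' : ℝ, ∀ i,
      (0 < H.mulVec αs i + b' - y i → αs i = l i) ∧
      (H.mulVec αs i + b' - y i < 0 → αs i = u i) := by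
  have hsymm : H.IsSymm := by simpa [IsHermitian, IsSymm] using hH.isHermitian
  have hf' (α : Fin n → ℝ) : f α = (1 / 2) * (α ⬝ᵥ H *ᵥ α) - y ⬝ᵥ α := by
    simp only [hf, dotProduct, mulVec, Finset.mul_sum, mul_assoc]
  have key (i j : Fin n) (hi : l i < αs i) (hj : αs j < u j) :
      (H *ᵥ αs - y) i ≤ (H *ᵥ αs - y) j := by
    rcases eq_or_ne i j with rfl | hij
    · exact le_rfl
    set d : Fin n → ℝ := Pi.single j 1 - Pi.single i 1 with hd
    have hδ : 0 < min (αs i - l i) (u j - αs j) := lt_min (sub_pos.2 hi) (sub_pos.2 hj)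
    have hslope : 0 ≤ d ⬝ᵥ (H *ᵥ αs - y) := by
      refine nonneg_of_forall_small_quadratic_nonneg (q := (1 / 2) * (d ⬝ᵥ H *ᵥ d)) hδ
        fun t ht0 ht => ?_
      obtain ⟨hti, htj⟩ := le_min_iff.1 ht
      have hle := hmin (αs + t • d) ⟨?_, fun k => ?_⟩
      · rw [hf', hf', quadratic_line_expansion hsymm] at hle
        linarith
      · simp [hd, Finset.sum_add_distrib, ← Finset.mul_sum, hfeas.1]
      · obtain ⟨hlk, huk⟩ := hfeas.2 k
        rcases eq_or_ne k i with rfl | hki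
        · simp only [hd, Pi.add_apply, Pi.smul_apply, Pi.sub_apply, Pi.single_eq_same,
            Pi.single_eq_of_ne hij, smul_eq_mul]
          constructor <;> linarith
        · rcases eq_or_ne k j with rfl | hkj
          · simp only [hd, Pi.add_apply, Pi.smul_apply, Pi.sub_apply, Pi.single_eq_same,
              Pi.single_eq_of_ne hki, smul_eq_mul]
            constructor <;> linarith
          · simpa [hd, hki, hkj] using hfeas.2 k
    rw [hd, sub_dotProduct, single_one_dotProduct, single_one_dotProduct] at hslope
    linarith
  obtain ⟨c, hlow, hup⟩ := exists_separating_value (H *ᵥ αs - y)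
    (P := fun i => l i < αs i) (Q := fun j => αs j < u j) key
  simp only [Pi.sub_apply] at hlow hup
  refine ⟨-c, fun i => ⟨fun hpos => ?_, fun hneg => ?_⟩⟩
  · by_contra hne
    linarith [hlow i (lt_of_le_of_ne (hfeas.2 i).1 (Ne.symm hne))]
  · by_contra hne
    linarith [hup i (lt_of_le_of_ne (hfeas.2 i).2 hne)]
end

section
/- Finite identification of the screening set (Property 2): let n in N, K : Fin n -> R with K_i > 0 for all i, d : Fin n -> R, and let (D_k)_{k in N} be a sequence of functions Fin n -> R and (G_k)_{k in N} a sequence of nonnegative reals such that G_k -> 0 as k -> infinity and |D_k(i) - d(i)| <= sqrt(K_i * G_k) for every k and every i. Then there exists k_0 in N such that for all k >= k_0, the set { i : |D_k(i)| <= sqrt(K_i * G_k) } equals the set { i : d(i) = 0 }. -/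
/-- Property 2: finite identification of the screening set. -/
theorem finite_identification_screening_set
    (n : ℕ) (K : Fin n → ℝ) (hK : ∀ i, 0 < K i) (dgrad : Fin n → ℝ)
    (D : ℕ → Fin n → ℝ) (G : ℕ → ℝ) (hG0 : ∀ k, 0 ≤ G k)
    (hGlim : Filter.Tendsto G Filter.atTop (nhds 0))
    (hbound : ∀ k i, |D k i - dgrad i| ≤ Real.sqrt (K i * G k)) :
    ∃ k0 : ℕ, ∀ k ≥ k0,
      {i : Fin n | |D k i| ≤ Real.sqrt (K i * G k)} = {i : Fin n | dgrad i = 0} := by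
  have hsqrt (i : Fin n) :
      Filter.Tendsto (fun k => Real.sqrt (K i * G k)) Filter.atTop (nhds 0) := by
    simpa using (hGlim.const_mul (K i)).sqrt
  have hsmall : ∀ᶠ k in Filter.atTop, ∀ i, dgrad i ≠ 0 →
      Real.sqrt (K i * G k) < |dgrad i| / 2 := by
    refine Filter.eventually_all.2 fun i => ?_
    by_cases hi : dgrad i = 0
    · simp [hi]
    · filter_upwards [(hsqrt i).eventually_lt_const (half_pos (abs_pos.2 hi))] with k hk _
      exact hk
  obtain ⟨k0, hk0⟩ := Filter.eventually_atTop.1 hsmall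
  refine ⟨k0, fun k hk => Set.ext fun i => ⟨fun hi => ?_, fun hi => ?_⟩⟩
  · by_contra hne
    have htri : |dgrad i| ≤ |D k i| + |D k i - dgrad i| := by
      simpa using abs_sub (D k i) (D k i - dgrad i)
    have hle : |D k i| ≤ Real.sqrt (K i * G k) := hi
    linarith [hk0 k hk i hne, hbound k i]
  · have hzero : dgrad i = 0 := hi
    simpa [hzero] using hbound k i
end

section
/- Propagating screening rule, lower-bound case (Property 3): let H in R^{n x n}, y in R^n, and define grad(alpha, b)_i = sum_{j=1}^n H_{ij}*alpha_j + b - y_i, and let I_i in R^n denote the i-th row of H. Let alpha, alpha' in R^n, b, b' in R, G, G' >= 0, K_i >= 0, and m, nu, q >= 0 satisfy ||alpha' - alpha||_2 <= m, |b' - b| <= nu, and sqrt(K_i * |G' - G|) <= q. If grad(alpha, b)_i - sqrt(K_i * G) - m*||I_i||_2 - nu - q > 0, then grad(alpha', b')_i > sqrt(K_i * G'). -/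
/-- Property 3, lower-bound case: propagating screening rule. -/
theorem propagating_screening_lower
    (n : ℕ) (H : Matrix (Fin n) (Fin n) ℝ) (y : Fin n → ℝ)
    (grad : (Fin n → ℝ) → ℝ → Fin n → ℝ)
    (hgrad : ∀ α b i, grad α b i = (∑ j, H i j * α j) + b - y i)
    (α α' : Fin n → ℝ) (b b' G G' : ℝ) (hG : 0 ≤ G) (hG' : 0 ≤ G')
    (i : Fin n) (Ki : ℝ) (hKi : 0 ≤ Ki)
    (m ν q : ℝ) (hm0 : 0 ≤ m) (hν0 : 0 ≤ ν) (hq0 : 0 ≤ q)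
    (hm : Real.sqrt (∑ j, (α' j - α j)^2) ≤ m)
    (hν : |b' - b| ≤ ν)
    (hq : Real.sqrt (Ki * |G' - G|) ≤ q)
    (hrule : 0 < grad α b i - Real.sqrt (Ki * G)
      - m * Real.sqrt (∑ j, (H i j)^2) - ν - q) :
    Real.sqrt (Ki * G') < grad α' b' i := by
  have hcs := Real.sum_mul_le_sqrt_mul_sqrt Finset.univ (H i) (fun j => α j - α' j)
  have hswap : ∑ j, (α j - α' j) ^ 2 = ∑ j, (α' j - α j) ^ 2 :=
    Finset.sum_congr rfl fun j _ => by ring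
  have hdiff : ∑ j, H i j * (α j - α' j) = ∑ j, H i j * α j - ∑ j, H i j * α' j := by
    simp only [mul_sub, Finset.sum_sub_distrib]
  rw [hswap, hdiff] at hcs
  have hmul := mul_le_mul_of_nonneg_left hm (Real.sqrt_nonneg (∑ j, (H i j) ^ 2))
  have hgap : Real.sqrt (Ki * G') ≤ Real.sqrt (Ki * G) + Real.sqrt (Ki * |G' - G|) := by
    have hle : Ki * G' ≤ Ki * G + Ki * |G' - G| := by
      rw [← mul_add]
      exact mul_le_mul_of_nonneg_left (by linarith [le_abs_self (G' - G)]) hKi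
    have h₁ := Real.sq_sqrt (mul_nonneg hKi hG)
    have h₂ := Real.sq_sqrt (mul_nonneg hKi (abs_nonneg (G' - G)))
    refine Real.sqrt_le_iff.mpr ⟨by positivity, ?_⟩
    nlinarith [mul_nonneg (Real.sqrt_nonneg (Ki * G)) (Real.sqrt_nonneg (Ki * |G' - G|))]
  rw [hgrad] at hrule ⊢
  linarith [(abs_le.mp hν).1]
end

section
/- Propagating screening rule, upper-bound case (Property 3): let H in R^{n x n}, y in R^n, and define grad(alpha, b)_i = sum_{j=1}^n H_{ij}*alpha_j + b - y_i, and let I_i in R^n denote the i-th row of H. Let alpha, alpha' in R^n, b, b' in R, G, G' >= 0, K_i >= 0, and m, nu, q >= 0 satisfy ||alpha' - alpha||_2 <= m, |b' - b| <= nu, and sqrt(K_i * |G' - G|) <= q. If grad(alpha, b)_i + sqrt(K_i * G) + m*||I_i||_2 + nu + q < 0, then grad(alpha', b')_i < -sqrt(K_i * G'). -/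
/-- Property 3, upper-bound case: propagating screening rule. -/
theorem propagating_screening_upper
    (n : ℕ) (H : Matrix (Fin n) (Fin n) ℝ) (y : Fin n → ℝ)
    (grad : (Fin n → ℝ) → ℝ → Fin n → ℝ)
    (hgrad : ∀ α b i, grad α b i = (∑ j, H i j * α j) + b - y i)
    (α α' : Fin n → ℝ) (b b' G G' : ℝ) (hG : 0 ≤ G) (hG' : 0 ≤ G')
    (i : Fin n) (Ki : ℝ) (hKi : 0 ≤ Ki)
    (m ν q : ℝ) (hm0 : 0 ≤ m) (hν0 : 0 ≤ ν) (hq0 : 0 ≤ q)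
    (hm : Real.sqrt (∑ j, (α' j - α j)^2) ≤ m)
    (hν : |b' - b| ≤ ν)
    (hq : Real.sqrt (Ki * |G' - G|) ≤ q)
    (hrule : grad α b i + Real.sqrt (Ki * G)
      + m * Real.sqrt (∑ j, (H i j)^2) + ν + q < 0) :
    grad α' b' i < -Real.sqrt (Ki * G') := by
  have hinner : ∑ j, H i j * (α' j - α j) ≤ m * √(∑ j, (H i j) ^ 2) := by
    calc ∑ j, H i j * (α' j - α j)
        ≤ √(∑ j, (H i j) ^ 2) * √(∑ j, (α' j - α j) ^ 2) :=
          Real.sum_mul_le_sqrt_mul_sqrt _ _ _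
      _ ≤ √(∑ j, (H i j) ^ 2) * m := by gcongr
      _ = m * √(∑ j, (H i j) ^ 2) := mul_comm _ _
  have hdiff : grad α' b' i - grad α b i = ∑ j, H i j * (α' j - α j) + (b' - b) := by
    simp only [hgrad, mul_sub, Finset.sum_sub_distrib]
    ring
  have hgap : √(Ki * G') ≤ √(Ki * G) + √(Ki * |G' - G|) := by
    calc √(Ki * G') ≤ √(Ki * G + Ki * |G' - G|) := by
          rw [← mul_add]
          gcongr
          linarith [le_abs_self (G' - G)]
      _ ≤ √(Ki * G) + √(Ki * |G' - G|) := by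
          refine Real.sqrt_le_iff.mpr ⟨by positivity, ?_⟩
          rw [add_sq, Real.sq_sqrt (by positivity), Real.sq_sqrt (by positivity)]
          linarith [mul_nonneg (Real.sqrt_nonneg (Ki * G)) (Real.sqrt_nonneg (Ki * |G' - G|))]
  linarith [le_abs_self (b' - b)]
end
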